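/- Let A ≥ 2, n, r, e, f be non-negative integers with e + f ≤ A(n+1) − 2, and set S = A if r ≥ n + 1 and S = 2A otherwise. Then the series Σ_{k_1 ≥ k_2 ≥ 1} (k_1 + k_2 + n + r)^e (k_1 − k_2 + r)^f / ((k_1+r)_{n+1}^A (k_2)_{n+1}^A) converges and is a ℚ-linear combination of 1, the values ζ(s) with 2 ≤ s ≤ S, and: if e and f are even, the sums ζ(s, s') + ζ(s', s) with 2 ≤ s ≤ s' ≤ A and s' ≡ s (mod 2); if e is even and f is odd, the differences ζ(s, s') − ζ(s', s) with 2 ≤ s < s' ≤ A and s' ≢ s (mod 2); if e is odd and f is even, the sums ζ(s, s') + ζ(s', s) with 2 ≤ s < s' ≤ A and s' ≢ s (mod 2); if e and f are odd, the differences ζ(s, s') − ζ(s', s) with 2 ≤ s < s' ≤ A and s' ≡ s (mod 2). -/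

import Mathlib

/-- The value `ζ(s) = ∑_{k ≥ 1} 1/k^s` of the Riemann zeta function. -/
noncomputable def zv (s : ℕ) : ℝ := ∑' k : ℕ+, ((k : ℝ) ^ s)⁻¹

/-- The double zeta value `ζ(s, t) = ∑_{k₁ > k₂ ≥ 1} 1/(k₁^s k₂^t)`. -/
noncomputable def dzv (s t : ℕ) : ℝ :=
  ∑' k : {q : ℕ × ℕ // q.2 < q.1 ∧ 1 ≤ q.2},
    ((k.1.1 : ℝ) ^ s * (k.1.2 : ℝ) ^ t)⁻¹

open Finset Polynomial

lemma ascPochhammer_eval_eq_prod_add (n : ℕ) (x : ℝ) :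
    (ascPochhammer ℝ n).eval x = ∏ i ∈ range n, (x + i) := by
  induction n with
  | zero => simp
  | succ n ih => rw [ascPochhammer_succ_right, prod_range_succ, ← ih]; simp

lemma coeff_C_mul_partialFraction {A n i j : ℕ} (hi : i ∈ range (n + 1)) (hj : j < A) (c : ℚ) :
    ((C c * (X + C (i : ℚ)) ^ j * ∏ k ∈ (range (n + 1)).erase i, (X + C (k : ℚ)) ^ A).natDegree
      < A * (n + 1)) ∧
    (C c * (X + C (i : ℚ)) ^ j * ∏ k ∈ (range (n + 1)).erase i, (X + C (k : ℚ)) ^ A).coeff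
      (A * (n + 1) - 1) = if j + 1 = A then c else 0 := by
  have hprod : (∏ k ∈ (range (n + 1)).erase i, (X + C (k : ℚ)) ^ A).Monic :=
    monic_prod_of_monic _ _ fun k _ => (monic_X_add_C _).pow A
  have hmonic := ((monic_X_add_C (i : ℚ)).pow j).mul hprod
  have hdeg : ((X + C (i : ℚ)) ^ j *
      ∏ k ∈ (range (n + 1)).erase i, (X + C (k : ℚ)) ^ A).natDegree = j + A * n := by
    rw [((monic_X_add_C (i : ℚ)).pow j).natDegree_mul hprod,
      natDegree_prod_of_monic _ _ fun k _ => (monic_X_add_C _).pow A]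
    simp [card_erase_of_mem hi, natDegree_pow, -map_natCast, mul_comm]
  rw [mul_assoc]
  refine ⟨(natDegree_C_mul_le _ _).trans_lt (by rw [hdeg]; nlinarith), ?_⟩
  rw [coeff_C_mul]
  split_ifs with h
  · have : A * (n + 1) - 1 = j + A * n := by subst h; rw [mul_add]; omega
    rw [this, ← hdeg, hmonic.coeff_natDegree, mul_one]
  · rw [coeff_eq_zero_of_natDegree_lt (by rw [hdeg, mul_add]; omega), mul_zero]

/-- Partial fraction expansion of a rational function with poles of order at most `A` at
`0, -1, …, -n`, vanishing to order at least two at infinity. -/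
lemma exists_partialFraction (A n : ℕ) (P : ℚ[X]) (hP : P.natDegree + 2 ≤ A * (n + 1)) :
    ∃ a : ℕ → ℕ → ℚ, ∑ i ∈ range (n + 1), a 1 i = 0 ∧
      ∀ x : ℝ, (∀ i ∈ range (n + 1), x + i ≠ 0) →
        aeval x P / (ascPochhammer ℝ (n + 1)).eval x ^ A =
          ∑ s ∈ Icc 1 A, ∑ i ∈ range (n + 1), (a s i : ℝ) / (x + i) ^ s := by
  have hA : 0 < A := Nat.pos_of_ne_zero (by rintro rfl; simp at hP)
  obtain ⟨q, r, hr, hf⟩ := eq_quo_mul_prod_pow_add_sum_rem_mul_prod_pow (s := range (n + 1)) P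
    (g := fun i : ℕ => X + C (i : ℚ)) (fun i _ => monic_X_add_C _)
    (fun i _ j _ hij => by
      have := pairwise_coprime_X_sub_C (K := ℚ) (s := fun i : ℕ => -(i : ℚ))
        (fun a b h => by simpa using h) hij
      simpa [Function.onFun] using this) (fun _ => A)
  have hrC : ∀ i ∈ range (n + 1), ∀ j : Fin A, r i j = C ((r i j).coeff 0) := fun i hi j =>
    eq_C_of_degree_le_zero (Nat.WithBot.lt_one_iff_le_zero.mp (by simpa [-map_natCast] using hr i hi j))
  set D := ∏ i ∈ range (n + 1), (X + C (i : ℚ)) ^ A with hD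
  set R := ∑ i ∈ range (n + 1), ∑ j : Fin A,
    r i j * (X + C (i : ℚ)) ^ (j : ℕ) * ∏ k ∈ (range (n + 1)).erase i, (X + C (k : ℚ)) ^ A with hR
  have hDm : D.Monic := monic_prod_of_monic _ _ fun k _ => (monic_X_add_C _).pow A
  have hDd : D.natDegree = A * (n + 1) := by
    rw [hD, natDegree_prod_of_monic _ _ fun k _ => (monic_X_add_C _).pow A]
    simp [natDegree_pow, -map_natCast, mul_comm]
  have hRd : R.natDegree < A * (n + 1) := by
    refine Nat.lt_of_le_pred (by positivity) (natDegree_sum_le_of_forall_le _ _ fun i hi =>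
      natDegree_sum_le_of_forall_le _ _ fun j _ => ?_)
    rw [hrC i hi]
    exact Nat.le_pred_of_lt (coeff_C_mul_partialFraction hi j.2 _).1
  have hRc : R.coeff (A * (n + 1) - 1) = ∑ i ∈ range (n + 1), (r i ⟨A - 1, by omega⟩).coeff 0 := by
    rw [hR, finsetSum_coeff]
    refine sum_congr rfl fun i hi => ?_
    rw [finsetSum_coeff, sum_eq_single ⟨A - 1, by omega⟩]
    · rw [hrC i hi, (coeff_C_mul_partialFraction hi (by simp; omega) _).2, if_pos (by simp; omega)]
      simp
    · intro j _ hj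
      rw [hrC i hi, (coeff_C_mul_partialFraction hi j.2 _).2, if_neg]
      contrapose! hj
      ext; simp; omega
    · simp
  have hq : q = 0 := by
    by_contra hq
    have h1 : (q * D).natDegree = q.natDegree + D.natDegree :=
      natDegree_mul hq hDm.ne_zero
    have h2 : q * D = P - R := by rw [hf]; ring
    have h3 := natDegree_sub_le P R
    rw [← h2, h1, hDd] at h3
    omega
  have hPR : P = R := by rw [hf, hq, zero_mul, zero_add]
  clear_value R
  refine ⟨fun s i => if h : A - s < A then (r i ⟨A - s, h⟩).coeff 0 else 0, ?_, fun x hx => ?_⟩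
  · simp only [show A - 1 < A by omega, dif_pos]
    rw [← hRc, ← hPR]
    exact coeff_eq_zero_of_natDegree_lt (by omega)
  · have hDx : aeval x D = (ascPochhammer ℝ (n + 1)).eval x ^ A := by
      rw [ascPochhammer_eval_eq_prod_add, hD, map_prod, ← prod_pow]
      simp
    rw [← hDx, hPR, hR, map_sum, sum_div, sum_comm]
    refine sum_congr rfl fun i hi => ?_
    have hx' := hx i hi
    have hDx' : aeval x D = (x + i) ^ A *
        aeval x (∏ k ∈ (range (n + 1)).erase i, (X + C (k : ℚ)) ^ A) := by
      rw [hD, ← mul_prod_erase _ _ hi]; simp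
    have hne : aeval x (∏ k ∈ (range (n + 1)).erase i, (X + C (k : ℚ)) ^ A) ≠ 0 := by
      rw [map_prod, prod_ne_zero_iff]
      intro k hk
      simpa using fun h => absurd h (hx k (mem_of_mem_erase hk))
    rw [map_sum, sum_div]
    simp only [map_mul]
    generalize aeval x (∏ k ∈ (range (n + 1)).erase i, (X + C (k : ℚ)) ^ A) = E at hDx' hne ⊢
    refine sum_bij (fun j _ => A - (j : ℕ)) (by intro j _; simp; omega)
      (by intro j _ k _ h; ext; omega)
      (by intro s hs; rw [mem_Icc] at hs; exact ⟨⟨A - s, by omega⟩, mem_univ _, by simp; omega⟩) ?_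
    intro j _
    have hj : A - (A - (j : ℕ)) = j := by omega
    have hpow : (x + i) ^ A = (x + i) ^ (j : ℕ) * (x + i) ^ (A - (j : ℕ)) := by
      rw [← pow_add]; congr 1; omega
    simp only [hj, j.2, dif_pos]
    rw [hDx', hpow, hrC i hi j]
    simp
    field_simp

/-- `C` is a family of partial fraction coefficients for the two-variable function `g`, with poles
of order at most `A` at `0, -1, …, -n` in each variable. -/
def IsPartialFraction (A n : ℕ) (g : ℝ → ℝ → ℝ) (C : ℕ → ℕ → ℕ → ℕ → ℚ) : Prop :=
  ∀ x y : ℝ, (∀ i ∈ range (n + 1), x + i ≠ 0) → (∀ i ∈ range (n + 1), y + i ≠ 0) →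
    g x y = ∑ s ∈ Icc 1 A, ∑ t ∈ Icc 1 A, ∑ i ∈ range (n + 1), ∑ j ∈ range (n + 1),
      (C s t i j : ℝ) / ((x + i) ^ s * (y + j) ^ t)

/-- The summand of the double series, as a function of `x = k₁ + r` and `y = k₂`. -/
noncomputable def summand (A n e f : ℕ) (x y : ℝ) : ℝ :=
  (x + y + n) ^ e * (x - y) ^ f /
    ((ascPochhammer ℝ (n + 1)).eval x ^ A * (ascPochhammer ℝ (n + 1)).eval y ^ A)

lemma exists_isPartialFraction (A n e f : ℕ) (h : e + f + 2 ≤ A * (n + 1)) :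
    ∃ C : ℕ → ℕ → ℕ → ℕ → ℚ, (∀ t j, ∑ i ∈ range (n + 1), C 1 t i j = 0) ∧
      (∀ s i, ∑ j ∈ range (n + 1), C s 1 i j = 0) ∧
      IsPartialFraction A n (summand A n e f) C := by
  have hP : ∀ q : ℕ × ℕ, q ∈ range (e + 1) ×ˢ range (f + 1) →
      (X ^ q.1 * X ^ q.2 : ℚ[X]).natDegree + 2 ≤ A * (n + 1) := by
    intro q hq
    rw [mem_product, mem_range, mem_range] at hq
    rw [← pow_add, natDegree_X_pow]
    omega
  have hQ : ∀ q : ℕ × ℕ, q ∈ range (e + 1) ×ˢ range (f + 1) →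
      ((X + C (n : ℚ)) ^ (e - q.1) * (-X) ^ (f - q.2) * C ((e.choose q.1 * f.choose q.2 : ℕ) : ℚ)
        : ℚ[X]).natDegree + 2 ≤ A * (n + 1) := by
    intro q hq
    rw [mem_product, mem_range, mem_range] at hq
    have h1 := natDegree_mul_le (p := (X + C (n : ℚ)) ^ (e - q.1)) (q := (-X) ^ (f - q.2))
    have h2 := natDegree_mul_C_le ((X + C (n : ℚ)) ^ (e - q.1) * (-X) ^ (f - q.2))
      ((e.choose q.1 * f.choose q.2 : ℕ) : ℚ)
    rw [natDegree_pow, natDegree_pow, natDegree_X_add_C, natDegree_neg, natDegree_X] at h1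
    omega
  choose! a ha0 ha using fun q hq => exists_partialFraction A n _ (hP q hq)
  choose! b hb0 hb using fun q hq => exists_partialFraction A n _ (hQ q hq)
  refine ⟨fun s t i j => ∑ q ∈ range (e + 1) ×ˢ range (f + 1), a q s i * b q t j, ?_, ?_, ?_⟩
  · intro t j
    rw [sum_comm]
    exact sum_eq_zero fun q hq => by rw [← sum_mul, ha0 q hq, zero_mul]
  · intro s i
    rw [sum_comm]
    exact sum_eq_zero fun q hq => by rw [← mul_sum, hb0 q hq, mul_zero]
  · intro x y hx hy
    have hnum : (x + y + n) ^ e * (x - y) ^ f = ∑ q ∈ range (e + 1) ×ˢ range (f + 1),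
        aeval x (X ^ q.1 * X ^ q.2 : ℚ[X]) *
          aeval y ((X + C (n : ℚ)) ^ (e - q.1) * (-X) ^ (f - q.2) *
            C ((e.choose q.1 * f.choose q.2 : ℕ) : ℚ)) := by
      rw [add_assoc, sub_eq_add_neg, add_pow, add_pow, sum_mul_sum, sum_product]
      refine sum_congr rfl fun k _ => sum_congr rfl fun l _ => ?_
      simp
      ring
    rw [summand, hnum, sum_div]
    calc _ = ∑ q ∈ range (e + 1) ×ˢ range (f + 1),
          (∑ s ∈ Icc 1 A, ∑ i ∈ range (n + 1), (a q s i : ℝ) / (x + i) ^ s) *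
            ∑ t ∈ Icc 1 A, ∑ j ∈ range (n + 1), (b q t j : ℝ) / (y + j) ^ t :=
          sum_congr rfl fun q hq => by rw [← ha q hq x hx, ← hb q hq y hy, div_mul_div_comm]
      _ = ∑ q ∈ range (e + 1) ×ˢ range (f + 1), ∑ s ∈ Icc 1 A, ∑ t ∈ Icc 1 A,
          ∑ i ∈ range (n + 1), ∑ j ∈ range (n + 1),
            (a q s i : ℝ) / (x + i) ^ s * ((b q t j : ℝ) / (y + j) ^ t) := by
          simp only [sum_mul_sum]
      _ = _ := by
          rw [sum_comm]; refine sum_congr rfl fun s _ => ?_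
          rw [sum_comm]; refine sum_congr rfl fun t _ => ?_
          rw [sum_comm]; refine sum_congr rfl fun i _ => ?_
          rw [sum_comm]; refine sum_congr rfl fun j _ => ?_
          push_cast
          rw [sum_div]
          exact sum_congr rfl fun q _ => by rw [div_mul_div_comm]

lemma IsPartialFraction.average {A n : ℕ} {g : ℝ → ℝ → ℝ} {C C' : ℕ → ℕ → ℕ → ℕ → ℚ}
    (h : IsPartialFraction A n g C) (h' : IsPartialFraction A n g C') :
    IsPartialFraction A n g fun s t i j => (C s t i j + C' s t i j) / 2 := by
  intro x y hx hy
  rw [← add_halves (g x y)]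
  nth_rw 1 [h x y hx hy]
  rw [h' x y hx hy]
  simp only [sum_div, ← sum_add_distrib]
  refine sum_congr rfl fun s _ => sum_congr rfl fun t _ => sum_congr rfl fun i _ =>
    sum_congr rfl fun j _ => ?_
  push_cast
  ring

lemma IsPartialFraction.swap {A n f : ℕ} {g : ℝ → ℝ → ℝ} {C : ℕ → ℕ → ℕ → ℕ → ℚ}
    (h : IsPartialFraction A n g C) (hg : ∀ x y, g y x = (-1) ^ f * g x y) :
    IsPartialFraction A n g fun s t i j => (-1) ^ f * C t s j i := by
  intro x y hx hy
  rw [hg y x, h y x hy hx]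
  simp only [mul_sum]
  rw [sum_comm]
  refine sum_congr rfl fun s _ => sum_congr rfl fun t _ => ?_
  rw [sum_comm]
  refine sum_congr rfl fun i _ => sum_congr rfl fun j _ => ?_
  push_cast
  ring

lemma IsPartialFraction.reflect {A n m : ℕ} {g : ℝ → ℝ → ℝ} {C : ℕ → ℕ → ℕ → ℕ → ℚ}
    (h : IsPartialFraction A n g C) (hg : ∀ x y, g (-n - x) (-n - y) = (-1) ^ m * g x y) :
    IsPartialFraction A n g fun s t i j => (-1) ^ (s + t + m) * C s t (n - i) (n - j) := by
  have hgood : ∀ x : ℝ, (∀ i ∈ range (n + 1), x + i ≠ 0) →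
      ∀ i ∈ range (n + 1), (-n - x) + i ≠ 0 := by
    intro x hx i hi h0
    have hi' : i ≤ n := Nat.lt_succ_iff.mp (mem_range.mp hi)
    refine hx (n - i) (mem_range.mpr (by omega)) ?_
    rw [Nat.cast_sub hi']
    linarith
  intro x y hx hy
  have hsq : ((-1 : ℝ) ^ m) * (-1) ^ m = 1 := by rw [← mul_pow]; simp
  rw [← one_mul (g x y), ← hsq, mul_assoc, ← hg, h _ _ (hgood x hx) (hgood y hy), mul_sum]
  refine sum_congr rfl fun s _ => ?_
  rw [mul_sum]
  refine sum_congr rfl fun t _ => ?_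
  rw [← sum_flip, mul_sum]
  refine sum_congr rfl fun i hi => ?_
  rw [← sum_flip, mul_sum]
  refine sum_congr rfl fun j hj => ?_
  rw [mem_range, Nat.lt_succ_iff] at hi hj
  have h1 : (-n - x + (n - i : ℕ) : ℝ) = (-1) * (x + i) := by rw [Nat.cast_sub hi]; ring
  have h2 : (-n - y + (n - j : ℕ) : ℝ) = (-1) * (y + j) := by rw [Nat.cast_sub hj]; ring
  have hs : ∀ k : ℕ, ((-1 : ℝ) ^ k)⁻¹ = (-1) ^ k := fun k => by rw [← inv_pow]; norm_num
  rw [h1, h2, mul_pow, mul_pow, div_eq_mul_inv, div_eq_mul_inv, mul_inv, mul_inv, mul_inv, hs, hs]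
  push_cast
  rw [pow_add, pow_add, mul_inv]
  ring

lemma summand_swap (A n e f : ℕ) (x y : ℝ) :
    summand A n e f y x = (-1) ^ f * summand A n e f x y := by
  have h : y - x = (-1) * (x - y) := by ring
  rw [summand, summand, h, mul_pow, add_comm y x, mul_comm (eval y _ ^ A)]
  ring

lemma summand_reflect (A n e f : ℕ) (x y : ℝ) :
    summand A n e f (-n - x) (-n - y) = (-1) ^ (e + f) * summand A n e f x y := by
  have hP : ∀ z : ℝ, (ascPochhammer ℝ (n + 1)).eval (-n - z) =
      (-1) ^ (n + 1) * (ascPochhammer ℝ (n + 1)).eval z := by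
    intro z
    rw [ascPochhammer_eval_eq_prod_add, ascPochhammer_eval_eq_prod_add, ← prod_range_reflect,
      ← card_range (n + 1), ← prod_const, card_range, ← prod_mul_distrib]
    refine prod_congr rfl fun i hi => ?_
    rw [mem_range, Nat.lt_succ_iff] at hi
    rw [show n + 1 - 1 - i = n - i by omega, Nat.cast_sub hi]
    ring
  have h1 : -n - x + (-n - y) + n = (-1) * (x + y + n) := by ring
  have h2 : -n - x - (-n - y) = (-1) * (x - y) := by ring
  have hsq : (((-1 : ℝ) ^ (n + 1)) ^ A) * ((-1) ^ (n + 1)) ^ A = 1 := by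
    rw [← mul_pow, ← mul_pow]; simp
  rw [summand, summand, hP, hP, h1, h2, mul_pow, mul_pow, mul_pow, mul_pow, mul_mul_mul_comm,
    mul_mul_mul_comm (((-1 : ℝ) ^ (n + 1)) ^ A), hsq, one_mul, pow_add, mul_div_assoc]

/-- Partial fraction coefficients of `summand` together with the symmetries of their totals. -/
lemma exists_symmetric_isPartialFraction (A n e f : ℕ) (h : e + f + 2 ≤ A * (n + 1)) :
    ∃ C : ℕ → ℕ → ℕ → ℕ → ℚ, IsPartialFraction A n (summand A n e f) C ∧
      (∀ t j, j ∈ range (n + 1) → ∑ i ∈ range (n + 1), C 1 t i j = 0) ∧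
      (∀ s t, ∑ i ∈ range (n + 1), ∑ j ∈ range (n + 1), C t s i j =
        (-1) ^ f * ∑ i ∈ range (n + 1), ∑ j ∈ range (n + 1), C s t i j) ∧
      ∀ s t, ∑ i ∈ range (n + 1), ∑ j ∈ range (n + 1), C s t i j =
        (-1) ^ (s + t + (e + f)) * ∑ i ∈ range (n + 1), ∑ j ∈ range (n + 1), C s t i j := by
  obtain ⟨C, h1, h2, hC⟩ := exists_isPartialFraction A n e f h
  have hC1 := hC.average (hC.swap (summand_swap A n e f))
  have hC2 := hC1.average (hC1.reflect (summand_reflect A n e f))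
  have hsq : ∀ k : ℕ, ((-1 : ℚ) ^ k) * (-1) ^ k = 1 := fun k => by rw [← mul_pow]; simp
  have total : ∀ s t, ∑ i ∈ range (n + 1), ∑ j ∈ range (n + 1), C s t (n - i) (n - j) =
      ∑ i ∈ range (n + 1), ∑ j ∈ range (n + 1), C s t i j := by
    intro s t
    rw [sum_flip fun i => ∑ j ∈ range (n + 1), C s t i (n - j)]
    exact sum_congr rfl fun i _ => sum_flip _
  have total' : ∀ s t, ∑ i ∈ range (n + 1), ∑ j ∈ range (n + 1), C s t (n - j) (n - i) =
      ∑ i ∈ range (n + 1), ∑ j ∈ range (n + 1), C s t i j := by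
    intro s t
    rw [sum_comm, total]
  have total'' : ∀ s t, ∑ i ∈ range (n + 1), ∑ j ∈ range (n + 1), C s t j i =
      ∑ i ∈ range (n + 1), ∑ j ∈ range (n + 1), C s t i j := fun s t => sum_comm
  refine ⟨_, hC2, ?_, ?_, ?_⟩
  · intro t j _
    simp only [← sum_div, sum_add_distrib, ← mul_sum]
    rw [h1, h2, sum_flip fun i => C 1 t i (n - j), h1, sum_flip fun i => C t 1 (n - j) i, h2]
    simp
  · intro s t
    simp only [← sum_div, sum_add_distrib, ← mul_sum, total, total', total'']
    rw [add_comm t s]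
    linear_combination (-(1 + (-1 : ℚ) ^ (s + t + (e + f))) / 4 *
      ∑ i ∈ range (n + 1), ∑ j ∈ range (n + 1), C t s i j) * hsq f
  · intro s t
    simp only [← sum_div, sum_add_distrib, ← mul_sum, total, total', total'']
    linear_combination (-((∑ i ∈ range (n + 1), ∑ j ∈ range (n + 1), C s t i j) + (-1 : ℚ) ^ f *
      ∑ i ∈ range (n + 1), ∑ j ∈ range (n + 1), C t s i j) / 4) * hsq (s + t + (e + f))

/-- The `ℚ`-span of `1` and the zeta values `ζ(s)` with `2 ≤ s ≤ N`. -/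
noncomputable def zetaSpan (N : ℕ) : Submodule ℚ ℝ where
  carrier := {x | ∃ (c₀ : ℚ) (c : ℕ → ℚ), x = c₀ + ∑ s ∈ Icc 2 N, (c s : ℝ) * zv s}
  add_mem' := by
    rintro _ _ ⟨a, c, rfl⟩ ⟨b, d, rfl⟩
    refine ⟨a + b, c + d, ?_⟩
    simp only [Pi.add_apply, Rat.cast_add, add_mul, sum_add_distrib]
    ring
  zero_mem' := ⟨0, 0, by simp⟩
  smul_mem' := by
    rintro q _ ⟨a, c, rfl⟩
    refine ⟨q * a, fun s => q * c s, ?_⟩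
    simp only [Rat.smul_def, Rat.cast_mul, mul_add, mul_sum, mul_assoc]

lemma ratCast_mem_zetaSpan (N : ℕ) (q : ℚ) : (q : ℝ) ∈ zetaSpan N := ⟨q, 0, by simp⟩

lemma ratCast_mul_mem_zetaSpan {N : ℕ} (q : ℚ) {v : ℝ} (hv : v ∈ zetaSpan N) :
    (q : ℝ) * v ∈ zetaSpan N := by
  rw [← Rat.smul_def]
  exact (zetaSpan N).smul_mem q hv

lemma zv_mem_zetaSpan {N s : ℕ} (h2 : 2 ≤ s) (hN : s ≤ N) : zv s ∈ zetaSpan N :=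
  ⟨0, fun t => if t = s then 1 else 0, by
    rw [sum_eq_single_of_mem s (mem_Icc.mpr ⟨h2, hN⟩) fun t _ ht => by simp [ht]]; simp⟩

/-- The real number `1/k^s`. -/
noncomputable def invPow (s k : ℕ) : ℝ := ((k : ℝ) ^ s)⁻¹

lemma invPow_nonneg (s k : ℕ) : 0 ≤ invPow s k := by unfold invPow; positivity

lemma invPow_anti_right (s : ℕ) {k m : ℕ} (hk : 1 ≤ k) (hkm : k ≤ m) : invPow s m ≤ invPow s k := by
  have hk' : (0 : ℝ) < k := by exact_mod_cast hk
  exact inv_anti₀ (by positivity) (pow_le_pow_left₀ hk'.le (by exact_mod_cast hkm) _)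

lemma invPow_mem_zetaSpan (N s k : ℕ) : invPow s k ∈ zetaSpan N := by
  have := ratCast_mem_zetaSpan N (((k : ℚ) ^ s)⁻¹)
  simpa [invPow] using this

lemma invPow_mul_mem_zetaSpan {N : ℕ} (s k : ℕ) {v : ℝ} (hv : v ∈ zetaSpan N) :
    invPow s k * v ∈ zetaSpan N := by
  have := ratCast_mul_mem_zetaSpan (((k : ℚ) ^ s)⁻¹) hv
  simpa [invPow] using this

lemma HasSum.of_eq {ι : Type*} {f g : ι → ℝ} {v : ℝ} (h : HasSum f v) (hfg : ∀ k, g k = f k) :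
    HasSum g v := by
  rwa [funext hfg]

lemma hasSum_invPow_sub_succ {s M : ℕ} (hs : 1 ≤ s) (hM : 1 ≤ M) :
    HasSum (fun a => invPow s (a + M) - invPow s (a + M + 1)) (invPow s M) := by
  rw [hasSum_iff_tendsto_nat_of_nonneg]
  · have h : ∀ N, ∑ a ∈ range N, (invPow s (a + M) - invPow s (a + M + 1)) =
        invPow s M - invPow s (N + M) := by
      intro N
      have := sum_range_sub' (fun a => invPow s (a + M)) N
      simpa [add_right_comm] using this
    simp only [h]
    have h0 : Filter.Tendsto (fun k : ℕ => invPow s k) Filter.atTop (nhds 0) := by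
      unfold invPow
      exact ((Filter.tendsto_pow_atTop (by omega)).comp tendsto_natCast_atTop_atTop).inv_tendsto_atTop
    simpa using ((h0.comp (Filter.tendsto_add_atTop_nat M)).const_sub (invPow s M))
  · exact fun a => sub_nonneg.mpr (invPow_anti_right s (by omega) (Nat.le_succ _))

lemma hasSum_invPow_sub_add {s y : ℕ} (hs : 1 ≤ s) (hy : 1 ≤ y) (l : ℕ) :
    HasSum (fun a => invPow s (a + y) - invPow s (a + (y + l))) (∑ k ∈ range l, invPow s (y + k)) := by
  induction l with
  | zero => simp
  | succ l ih =>
    rw [sum_range_succ]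
    refine (ih.add (hasSum_invPow_sub_succ (M := y + l) hs (by omega))).of_eq fun a => ?_
    simp [add_assoc]

lemma hasSum_invPow_sub {s y : ℕ} (hs : 1 ≤ s) (hy : 1 ≤ y) (l m : ℕ) :
    HasSum (fun a => invPow s (a + (y + l)) - invPow s (a + (y + m)))
      (∑ k ∈ range m, invPow s (y + k) - ∑ k ∈ range l, invPow s (y + k)) := by
  refine ((hasSum_invPow_sub_add hs hy m).sub (hasSum_invPow_sub_add hs hy l)).of_eq fun a => ?_
  ring

lemma summable_invPow {s : ℕ} (hs : 2 ≤ s) : Summable (invPow s) := by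
  unfold invPow
  simpa only [one_div] using Real.summable_one_div_nat_pow.mpr (show 1 < s by omega)

lemma hasSum_invPow_add {s : ℕ} (hs : 2 ≤ s) (a : ℕ) :
    HasSum (fun k => invPow s (k + (1 + a))) (zv s - ∑ k ∈ range a, invPow s (1 + k)) := by
  have h : HasSum (fun k => invPow s (k + 1)) (zv s) := by
    have : zv s = ∑' k : ℕ, invPow s (k + 1) := tsum_pnat_eq_tsum_succ (f := invPow s)
    rw [this]
    exact ((summable_nat_add_iff 1).mpr (summable_invPow hs)).hasSum
  have := h.sub (hasSum_invPow_sub_add (show 1 ≤ s by omega) le_rfl a)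
  simpa using this

lemma exists_hasSum_invPow_add {s N : ℕ} (hs : 2 ≤ s) (hN : s ≤ N) (a : ℕ) :
    ∃ v ∈ zetaSpan N, HasSum (fun k => invPow s (k + (1 + a))) v :=
  ⟨_, sub_mem (zv_mem_zetaSpan hs hN) (sum_mem fun _ _ => invPow_mem_zetaSpan _ _ _),
    hasSum_invPow_add hs a⟩

lemma invPow_succ_mul_invPow_succ {s t x y : ℕ} (hx : x ≠ 0) (hy : y ≠ 0) (hxy : x ≠ y) :
    invPow (s + 1) x * invPow (t + 1) y =
      (((y : ℚ) - x)⁻¹ : ℚ) * (invPow (s + 1) x * invPow t y - invPow s x * invPow (t + 1) y) := by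
  have hx' : (x : ℝ) ≠ 0 := by exact_mod_cast hx
  have hy' : (y : ℝ) ≠ 0 := by exact_mod_cast hy
  have hxy' : (y : ℝ) - x ≠ 0 := sub_ne_zero.mpr (by exact_mod_cast hxy.symm)
  unfold invPow
  push_cast
  field_simp
  ring

lemma exists_hasSum_invPow_mul_of_ne {a b N : ℕ} (hab : a ≠ b) (s t : ℕ) (hst : 2 ≤ s + t)
    (hs : s ≤ N) (ht : t ≤ N) :
    ∃ v ∈ zetaSpan N, HasSum (fun k => invPow s (k + (1 + a)) * invPow t (k + (1 + b))) v := by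
  have h0 : ∀ k, invPow 0 k = 1 := fun k => by simp [invPow]
  induction hn : s + t generalizing s t with
  | zero => omega
  | succ m ih =>
    rcases s with _ | s
    · simpa [h0] using exists_hasSum_invPow_add (by omega) ht b
    rcases t with _ | t
    · simpa [h0] using exists_hasSum_invPow_add (by omega) hs a
    obtain ⟨v, hv, hsum⟩ : ∃ v ∈ zetaSpan N, HasSum (fun k =>
        invPow (s + 1) (k + (1 + a)) * invPow t (k + (1 + b)) -
          invPow s (k + (1 + a)) * invPow (t + 1) (k + (1 + b))) v := by
      rcases Nat.eq_zero_or_pos (s + t) with hst0 | hst0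
      · obtain ⟨rfl, rfl⟩ : s = 0 ∧ t = 0 := by omega
        refine ⟨_, ?_, by simpa [h0] using hasSum_invPow_sub (s := 1) le_rfl le_rfl a b⟩
        exact sub_mem (sum_mem fun _ _ => invPow_mem_zetaSpan _ _ _)
          (sum_mem fun _ _ => invPow_mem_zetaSpan _ _ _)
      · obtain ⟨v, hv, h1⟩ := ih (s + 1) t (by omega) hs (by omega) (by omega)
        obtain ⟨w, hw, h2⟩ := ih s (t + 1) (by omega) (by omega) ht (by omega)
        exact ⟨v - w, sub_mem hv hw, h1.sub h2⟩
    refine ⟨_, ratCast_mul_mem_zetaSpan (((b : ℚ) - a)⁻¹) hv, ?_⟩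
    refine (hsum.mul_left ((((b : ℚ) - a)⁻¹ : ℚ) : ℝ)).of_eq fun k => ?_
    rw [invPow_succ_mul_invPow_succ (by omega) (by omega) (by omega)]
    push_cast
    congr 2
    ring

lemma exists_hasSum_invPow_mul {a b N : ℕ} {s t : ℕ} (hs : 1 ≤ s) (ht : 1 ≤ t)
    (hN : s + t ≤ N) :
    ∃ v ∈ zetaSpan N, HasSum (fun k => invPow s (k + (1 + a)) * invPow t (k + (1 + b))) v := by
  rcases eq_or_ne a b with rfl | hab
  · have := exists_hasSum_invPow_add (show 2 ≤ s + t by omega) hN a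
    simpa [invPow, pow_add, mul_comm] using this
  · exact exists_hasSum_invPow_mul_of_ne hab s t (by omega) (by omega) (by omega)

/-- The tail `∑_{k ≥ M} 1/k^s`. -/
noncomputable def zetaTail (s M : ℕ) : ℝ := ∑' a : ℕ, invPow s (a + M)

lemma hasSum_zetaTail {s : ℕ} (hs : 2 ≤ s) (M : ℕ) :
    HasSum (fun a => invPow s (a + M)) (zetaTail s M) :=
  ((summable_nat_add_iff M).mpr (summable_invPow hs)).hasSum

lemma zetaTail_mem_zetaSpan {s N : ℕ} (hs : 2 ≤ s) (hN : s ≤ N) (M : ℕ) :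
    zetaTail s (1 + M) ∈ zetaSpan N := by
  obtain ⟨v, hv, h⟩ := exists_hasSum_invPow_add hs hN M
  rwa [zetaTail, h.tsum_eq]

lemma invPow_anti_left {s t k : ℕ} (hst : s ≤ t) (hk : 1 ≤ k) : invPow t k ≤ invPow s k := by
  have hk' : (1 : ℝ) ≤ k := by exact_mod_cast hk
  exact inv_anti₀ (by positivity) (pow_le_pow_right₀ hk' hst)

lemma zetaTail_le {s M : ℕ} (hs : 2 ≤ s) (hM : 1 ≤ M) : zetaTail s (M + 1) ≤ invPow 1 M := by
  refine hasSum_le (fun a => ?_) (hasSum_zetaTail hs (M + 1))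
    (hasSum_invPow_sub_succ (s := 1) le_rfl hM)
  refine (invPow_anti_left hs (by omega)).trans ?_
  have hm : (0 : ℝ) < a + M := by exact_mod_cast (by omega : 0 < a + M)
  have : invPow 1 (a + M) - invPow 1 (a + M + 1) - invPow 2 (a + (M + 1)) =
      (((a : ℝ) + M) * (a + M + 1) ^ 2)⁻¹ := by
    unfold invPow
    push_cast
    field_simp
    ring
  rw [← sub_nonneg, this]
  positivity

lemma hasSum_dzv {s t : ℕ} (hs : 2 ≤ s) (ht : 1 ≤ t) :
    HasSum (fun b => invPow t (b + 1) * zetaTail s (b + 1 + 1)) (dzv s t) := by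
  let E : ℕ × ℕ ≃ {q : ℕ × ℕ // q.2 < q.1 ∧ 1 ≤ q.2} :=
    { toFun := fun p => ⟨(p.2 + (p.1 + 1 + 1), p.1 + 1), by dsimp only; omega, by dsimp only; omega⟩
      invFun := fun q => (q.1.2 - 1, q.1.1 - q.1.2 - 1)
      left_inv := fun p => by ext <;> simp; omega
      right_inv := fun q => by
        obtain ⟨⟨a, b⟩, h1, h2⟩ := q
        dsimp only at h1 h2
        ext <;> dsimp only <;> omega }
  have hinner : ∀ b, HasSum (fun a => invPow t (b + 1) * invPow s (a + (b + 1 + 1)))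
      (invPow t (b + 1) * zetaTail s (b + 1 + 1)) := fun b => (hasSum_zetaTail hs _).mul_left _
  have hsum : Summable fun p : ℕ × ℕ => invPow t (p.1 + 1) * invPow s (p.2 + (p.1 + 1 + 1)) := by
    rw [summable_prod_of_nonneg fun p => mul_nonneg (invPow_nonneg _ _) (invPow_nonneg _ _)]
    refine ⟨fun b => (hinner b).summable, ?_⟩
    simp only [(hinner _).tsum_eq]
    refine Summable.of_nonneg_of_le (fun b => mul_nonneg (invPow_nonneg _ _)
      (tsum_nonneg fun _ => invPow_nonneg _ _)) (fun b => ?_)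
      ((summable_nat_add_iff 1).mpr (summable_invPow le_rfl))
    calc _ ≤ invPow 1 (b + 1) * invPow 1 (b + 1) :=
          mul_le_mul (invPow_anti_left ht (by omega)) (zetaTail_le hs (by omega))
            (tsum_nonneg fun _ => invPow_nonneg _ _) (invPow_nonneg _ _)
      _ = invPow 2 (b + 1) := by simp only [invPow]; rw [← mul_inv]; ring_nf
  have hval : dzv s t = ∑' p : ℕ × ℕ, invPow t (p.1 + 1) * invPow s (p.2 + (p.1 + 1 + 1)) := by
    rw [dzv, ← E.tsum_eq]
    refine tsum_congr fun p => ?_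
    rw [mul_comm, mul_inv]
    rfl
  rw [hval]
  exact hsum.hasSum.prod_fiberwise hinner

lemma exists_hasSum_dzv_sub {s t N : ℕ} (hs : 2 ≤ s) (ht : 1 ≤ t) (hN : s ≤ N) (j : ℕ) :
    ∃ v ∈ zetaSpan N,
      HasSum (fun b => invPow t (b + (1 + j)) * zetaTail s (1 + b + (j + 1))) (v + dzv s t) := by
  refine ⟨-∑ k ∈ range j, invPow t (k + 1) * zetaTail s (k + 1 + 1), ?_, ?_⟩
  · refine neg_mem (sum_mem fun k _ => invPow_mul_mem_zetaSpan _ _ ?_)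
    rw [add_comm]
    exact zetaTail_mem_zetaSpan hs hN _
  · have := (hasSum_nat_add_iff' j).mpr (hasSum_dzv hs ht)
    rw [neg_add_eq_sub]
    refine this.of_eq fun b => ?_
    congr 2 <;> ring

lemma exists_hasSum_sum {ι : Type*} {N : ℕ} (F : Finset ι) (f : ι → ℕ → ℝ)
    (h : ∀ i ∈ F, ∃ v ∈ zetaSpan N, HasSum (f i) v) :
    ∃ v ∈ zetaSpan N, HasSum (fun b => ∑ i ∈ F, f i b) v := by
  choose! v hv hsum using h
  exact ⟨∑ i ∈ F, v i, sum_mem hv, hasSum_sum hsum⟩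

lemma exists_hasSum_invPow_mul_sum_sub {A n r s t i j : ℕ} (hs : s ∈ Icc 1 A) (ht : t ∈ Icc 1 A)
    (hj : j ∈ range (n + 1)) :
    ∃ v ∈ zetaSpan (if n + 1 ≤ r then A else 2 * A),
      HasSum (fun b => invPow t (b + (1 + j)) * (∑ k ∈ range (j + 1), invPow s (1 + b + k) -
        ∑ k ∈ range (r + i), invPow s (1 + b + k))) v := by
  rw [mem_Icc] at hs ht
  rw [mem_range] at hj
  split_ifs with hr
  · obtain ⟨v, hv, h⟩ := exists_hasSum_sum (N := A) (Ico (j + 1) (r + i))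
      (fun k b => invPow t (b + (1 + j)) * invPow s (b + (1 + k))) fun k hk =>
        exists_hasSum_invPow_mul_of_ne (by rw [mem_Ico] at hk; omega) t s (by omega) ht.2 hs.2
    refine ⟨-v, neg_mem hv, h.neg.of_eq fun b => ?_⟩
    rw [← mul_sum, ← mul_neg, sum_Ico_eq_sub _ (by omega : j + 1 ≤ r + i), neg_sub]
    simp only [← add_assoc, add_comm b 1]
  · have key : ∀ m, ∃ v ∈ zetaSpan (2 * A),
        HasSum (fun b => ∑ k ∈ range m, invPow t (b + (1 + j)) * invPow s (b + (1 + k))) v :=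
      fun m => exists_hasSum_sum _ _ fun k _ => exists_hasSum_invPow_mul ht.1 hs.1 (by omega)
    obtain ⟨v, hv, h1⟩ := key (j + 1)
    obtain ⟨w, hw, h2⟩ := key (r + i)
    refine ⟨v - w, sub_mem hv hw, (h1.sub h2).of_eq fun b => ?_⟩
    rw [← mul_sum, ← mul_sum, ← mul_sub]
    simp only [← add_assoc, add_comm b 1]

/-- The sum over `a ≥ 0` of `∑ᵢ cᵢ/(y + a + r + i)^s`, written through the tail starting at
`y + j + 1`. -/
noncomputable def innerSum (n r s j : ℕ) (c : ℕ → ℚ) (y : ℕ) : ℝ :=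
  ∑ i ∈ range (n + 1), (c i : ℝ) *
      (∑ k ∈ range (j + 1), invPow s (y + k) - ∑ k ∈ range (r + i), invPow s (y + k)) +
    ((∑ i ∈ range (n + 1), c i : ℚ) : ℝ) * zetaTail s (y + (j + 1))

lemma hasSum_innerSum {n s y : ℕ} (r j : ℕ) {c : ℕ → ℚ} (hs : 1 ≤ s)
    (hc : s = 1 → ∑ i ∈ range (n + 1), c i = 0) (hy : 1 ≤ y) :
    HasSum (fun a => ∑ i ∈ range (n + 1), (c i : ℝ) * invPow s (a + (y + (r + i))))
      (innerSum n r s j c y) := by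
  have h1 : HasSum (fun a => ∑ i ∈ range (n + 1),
      (c i : ℝ) * (invPow s (a + (y + (r + i))) - invPow s (a + (y + (j + 1))))) _ :=
    hasSum_sum fun i _ => (hasSum_invPow_sub hs hy (r + i) (j + 1)).mul_left (c i : ℝ)
  have h2 : HasSum (fun a => ((∑ i ∈ range (n + 1), c i : ℚ) : ℝ) * invPow s (a + (y + (j + 1))))
      (((∑ i ∈ range (n + 1), c i : ℚ) : ℝ) * zetaTail s (y + (j + 1))) := by
    rcases eq_or_ne s 1 with h | h
    · simp [-Rat.cast_sum, hc h]
    · exact (hasSum_zetaTail (by omega) _).mul_left _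
  refine (h1.add h2).of_eq fun a => ?_
  rw [Rat.cast_sum, sum_mul, ← sum_add_distrib]
  exact sum_congr rfl fun i _ => by ring

lemma exists_hasSum_innerSum {A n r s t j : ℕ} {c : ℕ → ℚ} (hs : s ∈ Icc 1 A) (ht : t ∈ Icc 1 A)
    (hj : j ∈ range (n + 1)) (hc : s = 1 → ∑ i ∈ range (n + 1), c i = 0) :
    ∃ v ∈ zetaSpan (if n + 1 ≤ r then A else 2 * A),
      HasSum (fun b => invPow t (b + (1 + j)) * innerSum n r s j c (1 + b))
        (v + ((∑ i ∈ range (n + 1), c i : ℚ) : ℝ) * dzv s t) := by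
  obtain ⟨v, hv, h1⟩ := exists_hasSum_sum (range (n + 1)) (fun i b => (c i : ℝ) *
      (invPow t (b + (1 + j)) * (∑ k ∈ range (j + 1), invPow s (1 + b + k) -
        ∑ k ∈ range (r + i), invPow s (1 + b + k)))) fun i _ => by
    obtain ⟨v, hv, h⟩ := exists_hasSum_invPow_mul_sum_sub (r := r) (i := i) hs ht hj
    exact ⟨_, ratCast_mul_mem_zetaSpan (c i) hv, h.mul_left _⟩
  rw [mem_Icc] at hs ht
  obtain ⟨w, hw, h2⟩ : ∃ w ∈ zetaSpan (if n + 1 ≤ r then A else 2 * A),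
      HasSum (fun b => ((∑ i ∈ range (n + 1), c i : ℚ) : ℝ) *
        (invPow t (b + (1 + j)) * zetaTail s (1 + b + (j + 1))))
        (w + ((∑ i ∈ range (n + 1), c i : ℚ) : ℝ) * dzv s t) := by
    rcases eq_or_ne s 1 with h | h
    · exact ⟨0, zero_mem _, by simp [-Rat.cast_sum, hc h]⟩
    · obtain ⟨w, hw, h2⟩ := exists_hasSum_dzv_sub (s := s) (t := t)
        (N := if n + 1 ≤ r then A else 2 * A) (by omega) ht.1 (by split_ifs <;> omega) j
      refine ⟨_, ratCast_mul_mem_zetaSpan (∑ i ∈ range (n + 1), c i) hw, ?_⟩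
      rw [← mul_add]
      exact h2.mul_left _
  refine ⟨v + w, add_mem hv hw, ?_⟩
  rw [add_assoc]
  refine (h1.add h2).of_eq fun b => ?_
  rw [innerSum, mul_add, mul_sum]
  congr 1
  · exact sum_congr rfl fun i _ => by ring
  · ring

lemma pow_le_ascPochhammer_eval {x : ℝ} (hx : 0 ≤ x) (n : ℕ) :
    x ^ n ≤ (ascPochhammer ℝ n).eval x := by
  rw [ascPochhammer_eval_eq_prod_add, ← card_range n, ← prod_const, card_range]
  exact prod_le_prod (fun _ _ => hx) fun i _ => by simp

lemma abs_summand_le {A n e f : ℕ} (h : e + f + 2 ≤ A * (n + 1)) {x y : ℝ} (hy : 1 ≤ y)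
    (hyx : y ≤ x) : |summand A n e f x y| ≤ (n + 2) ^ e * ((x ^ 2)⁻¹ * (y ^ 2)⁻¹) := by
  have hx : 1 ≤ x := hy.trans hyx
  have hn : (n : ℝ) ≤ n * x := le_mul_of_one_le_right (Nat.cast_nonneg n) hx
  have key : ∀ z : ℝ, 1 ≤ z → z ^ (A * (n + 1)) ≤ (ascPochhammer ℝ (n + 1)).eval z ^ A := by
    intro z hz
    rw [mul_comm, pow_mul]
    exact pow_le_pow_left₀ (by positivity) (pow_le_ascPochhammer_eval (by linarith) _) _
  have hX : x ^ (e + f) * x ^ 2 ≤ (ascPochhammer ℝ (n + 1)).eval x ^ A := by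
    rw [← pow_add]
    exact (pow_le_pow_right₀ hx h).trans (key x hx)
  have hY : y ^ 2 ≤ (ascPochhammer ℝ (n + 1)).eval y ^ A :=
    (pow_le_pow_right₀ hy (by omega)).trans (key y hy)
  have hx0 : 0 < x := by linarith
  have hy0 : 0 < y := by linarith
  have hX0 := (by positivity : 0 < x ^ (e + f) * x ^ 2).trans_le hX
  have hY0 := (by positivity : 0 < y ^ 2).trans_le hY
  have h1 : |x + y + n| ≤ (n + 2) * x := by rw [abs_of_nonneg (by positivity)]; linarith
  have h2 : |x - y| ≤ x := by rw [abs_of_nonneg (by linarith)]; linarith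
  rw [summand, abs_div, abs_mul, abs_pow, abs_pow, abs_of_pos (mul_pos hX0 hY0)]
  calc _ ≤ ((n + 2) * x) ^ e * x ^ f / ((x ^ (e + f) * x ^ 2) * y ^ 2) := by gcongr
    _ = _ := by
      rw [mul_pow, pow_add]
      field_simp

lemma summable_summand {A n e f : ℕ} (r : ℕ) (h : e + f + 2 ≤ A * (n + 1)) :
    Summable fun p : ℕ × ℕ =>
      summand A n e f ((p.2 + (1 + p.1 + r) : ℕ) : ℝ) ((1 + p.1 : ℕ) : ℝ) := by
  have h1 : Summable fun k => invPow 2 (k + 1) :=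
    (summable_nat_add_iff 1).mpr (summable_invPow le_rfl)
  refine Summable.of_norm_bounded ((h1.mul_of_nonneg h1 (fun _ => invPow_nonneg _ _)
    fun _ => invPow_nonneg _ _).mul_left ((n + 2 : ℝ) ^ e)) fun p => ?_
  rw [Real.norm_eq_abs]
  refine (abs_summand_le h (by exact_mod_cast (by omega)) (by exact_mod_cast (by omega))).trans ?_
  rw [mul_comm (invPow 2 _)]
  exact mul_le_mul_of_nonneg_left (mul_le_mul (invPow_anti_right 2 (by omega) (by omega))
    (invPow_anti_right 2 (by omega) (by omega)) (invPow_nonneg _ _) (invPow_nonneg _ _))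
    (by positivity)

/-- The lower triangle `{(k₁, k₂) : k₁ ≥ k₂ ≥ 1}`, parametrized by `k₂ - 1` and `k₁ - k₂`. -/
def triangleEquiv : ℕ × ℕ ≃ {q : ℕ × ℕ // q.2 ≤ q.1 ∧ 1 ≤ q.2} where
  toFun p := ⟨(p.2 + (1 + p.1), 1 + p.1), by dsimp only; omega, by dsimp only; omega⟩
  invFun q := (q.1.2 - 1, q.1.1 - q.1.2)
  left_inv p := by ext <;> simp
  right_inv q := by
    obtain ⟨⟨a, b⟩, h1, h2⟩ := q
    dsimp only at h1 h2
    ext <;> dsimp only <;> omega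

lemma summand_eq_sum_invPow {A n : ℕ} {g : ℝ → ℝ → ℝ} {C : ℕ → ℕ → ℕ → ℕ → ℚ}
    (hC : IsPartialFraction A n g C) (r a b : ℕ) :
    g ((a + (1 + b + r) : ℕ) : ℝ) ((1 + b : ℕ) : ℝ) =
      ∑ t ∈ Icc 1 A, ∑ j ∈ range (n + 1), ∑ s ∈ Icc 1 A, invPow t (b + (1 + j)) *
        ∑ i ∈ range (n + 1), (C s t i j : ℝ) * invPow s (a + (1 + b + (r + i))) := by
  rw [hC _ _ (fun i _ => by positivity) (fun i _ => by positivity), sum_comm]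
  refine sum_congr rfl fun t _ => ?_
  rw [sum_comm (s := range (n + 1))]
  refine sum_congr rfl fun s _ => ?_
  rw [sum_comm]
  refine sum_congr rfl fun j _ => ?_
  rw [mul_sum]
  refine sum_congr rfl fun i _ => ?_
  have h1 : ((a + (1 + b + r) : ℕ) : ℝ) + i = ((a + (1 + b + (r + i)) : ℕ) : ℝ) := by
    push_cast; ring
  have h2 : ((1 + b : ℕ) : ℝ) + j = ((b + (1 + j) : ℕ) : ℝ) := by push_cast; ring
  rw [h1, h2, invPow, invPow, div_eq_mul_inv, mul_inv]
  ring

/-- The double series is a zeta combination plus the double zeta values weighted by the totals of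
the partial fraction coefficients. -/
lemma exists_tsum_eq {A n r : ℕ} {g : ℝ → ℝ → ℝ} {C : ℕ → ℕ → ℕ → ℕ → ℚ}
    (hC : IsPartialFraction A n g C)
    (hC1 : ∀ t j, j ∈ range (n + 1) → ∑ i ∈ range (n + 1), C 1 t i j = 0)
    (hsum : Summable fun p : ℕ × ℕ => g ((p.2 + (1 + p.1 + r) : ℕ) : ℝ) ((1 + p.1 : ℕ) : ℝ)) :
    ∃ v ∈ zetaSpan (if n + 1 ≤ r then A else 2 * A),
      ∑' p : ℕ × ℕ, g ((p.2 + (1 + p.1 + r) : ℕ) : ℝ) ((1 + p.1 : ℕ) : ℝ) =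
        v + ∑ s ∈ Icc 1 A, ∑ t ∈ Icc 1 A,
          ((∑ i ∈ range (n + 1), ∑ j ∈ range (n + 1), C s t i j : ℚ) : ℝ) * dzv s t := by
  have hinner : ∀ b, HasSum (fun a => g ((a + (1 + b + r) : ℕ) : ℝ) ((1 + b : ℕ) : ℝ))
      (∑ t ∈ Icc 1 A, ∑ j ∈ range (n + 1), ∑ s ∈ Icc 1 A,
        invPow t (b + (1 + j)) * innerSum n r s j (fun i => C s t i j) (1 + b)) := by
    intro b
    simp only [summand_eq_sum_invPow hC]
    exact hasSum_sum fun t _ => hasSum_sum fun j hj => hasSum_sum fun s hs =>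
      (hasSum_innerSum r j (mem_Icc.mp hs).1 (by rintro rfl; exact hC1 t j hj)
        (by omega)).mul_left _
  have houter := fun t (ht : t ∈ Icc 1 A) j (hj : j ∈ range (n + 1)) s (hs : s ∈ Icc 1 A) =>
    exists_hasSum_innerSum (r := r) (c := fun i => C s t i j) hs ht hj
      (by rintro rfl; exact hC1 t j hj)
  choose! v hv hvsum using houter
  have htotal := hasSum_sum fun t ht => hasSum_sum fun j hj => hasSum_sum fun s hs =>
    hvsum t ht j hj s hs
  refine ⟨∑ t ∈ Icc 1 A, ∑ j ∈ range (n + 1), ∑ s ∈ Icc 1 A, v t j s,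
    sum_mem fun t ht => sum_mem fun j hj => sum_mem fun s hs => hv t ht j hj s hs, ?_⟩
  rw [(hsum.hasSum.prod_fiberwise hinner).unique htotal]
  simp only [sum_add_distrib]
  congr 1
  rw [sum_comm (s := Icc 1 A) (t := Icc 1 A)]
  refine sum_congr rfl fun t _ => ?_
  rw [sum_comm]
  refine sum_congr rfl fun s _ => ?_
  rw [← sum_mul, sum_comm (s := range (n + 1)), Rat.cast_sum]

/-- Folding a sum over a square with symmetric or antisymmetric weights onto a triangle. -/
lemma sum_product_eq_sum_filter_symm (I : Finset ℕ) (f : ℕ) (c : ℕ → ℕ → ℚ) (D : ℕ → ℕ → ℝ)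
    (p : ℕ × ℕ → Prop) [DecidablePred p] (hsymm : ∀ s t, c t s = (-1) ^ f * c s t)
    (hp : ∀ q, ¬ p q → c q.1 q.2 = 0) :
    ∑ s ∈ I, ∑ t ∈ I, (c s t : ℝ) * D s t =
      ∑ q ∈ (I ×ˢ I).filter (fun q => q.1 ≤ q.2 ∧ p q),
        ((if q.1 = q.2 then c q.1 q.2 / 2 else c q.1 q.2 : ℚ) : ℝ) *
          (D q.1 q.2 + (-1) ^ f * D q.2 q.1) := by
  have hsymm' : ∀ s t, (c t s : ℝ) = (-1) ^ f * c s t := fun s t => by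
    rw [hsymm s t]; push_cast; ring
  set w : ℕ → ℕ → ℝ := fun s t => if s = t then (c s t : ℝ) / 2 else if s < t then c s t else 0
    with hw
  have hR : ∑ q ∈ (I ×ˢ I).filter (fun q => q.1 ≤ q.2 ∧ p q),
        ((if q.1 = q.2 then c q.1 q.2 / 2 else c q.1 q.2 : ℚ) : ℝ) *
          (D q.1 q.2 + (-1) ^ f * D q.2 q.1) =
      ∑ s ∈ I, ∑ t ∈ I, w s t * (D s t + (-1) ^ f * D t s) := by
    rw [sum_filter, sum_product]
    refine sum_congr rfl fun s _ => sum_congr rfl fun t _ => ?_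
    by_cases hq : p (s, t)
    · rcases lt_trichotomy s t with h | h | h
      · simp [hw, hq, h, h.le, h.ne]
      · subst h
        simp [hw, hq]
      · simp [hw, h.ne', h.not_gt, h.not_ge]
    · have := hp _ hq
      dsimp only at this
      simp [hw, hq, this]
  have hswap : ∑ s ∈ I, ∑ t ∈ I, w s t * ((-1) ^ f * D t s) =
      ∑ s ∈ I, ∑ t ∈ I, w t s * ((-1) ^ f * D s t) := sum_comm
  rw [hR]
  simp only [mul_add, sum_add_distrib]
  rw [hswap, ← sum_add_distrib]
  refine sum_congr rfl fun s _ => ?_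
  rw [← sum_add_distrib]
  refine sum_congr rfl fun t _ => ?_
  rcases lt_trichotomy s t with h | h | h
  · simp [hw, h, h.ne, h.ne', h.not_gt]
  · subst h
    simp only [hw, if_true]
    linear_combination (D s s / 2) * hsymm' s s
  · simp only [hw, h, h.ne, h.ne', h.not_gt, if_true, if_false]
    linear_combination (D s t) * hsymm' t s

theorem statement13 (A n r e f : ℕ) (hA : 2 ≤ A) (hef : e + f + 2 ≤ A * (n + 1)) :
    Summable (fun k : {q : ℕ × ℕ // q.2 ≤ q.1 ∧ 1 ≤ q.2} =>
        (((k.1.1 : ℝ) + k.1.2 + n + r) ^ e * ((k.1.1 : ℝ) - k.1.2 + r) ^ f) /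
          (((ascPochhammer ℝ (n + 1)).eval ((k.1.1 : ℝ) + r)) ^ A *
            ((ascPochhammer ℝ (n + 1)).eval (k.1.2 : ℝ)) ^ A)) ∧
    ∃ (c₀ : ℚ) (c : ℕ → ℚ) (d : ℕ × ℕ → ℚ),
      (∑' k : {q : ℕ × ℕ // q.2 ≤ q.1 ∧ 1 ≤ q.2},
          (((k.1.1 : ℝ) + k.1.2 + n + r) ^ e * ((k.1.1 : ℝ) - k.1.2 + r) ^ f) /
            (((ascPochhammer ℝ (n + 1)).eval ((k.1.1 : ℝ) + r)) ^ A *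
              ((ascPochhammer ℝ (n + 1)).eval (k.1.2 : ℝ)) ^ A))
        = c₀ + (∑ s ∈ Finset.Icc 2 (if n + 1 ≤ r then A else 2 * A), (c s : ℝ) * zv s) +
          ∑ q ∈ (Finset.Icc 2 A ×ˢ Finset.Icc 2 A).filter
              (fun q => q.1 ≤ q.2 ∧ (q.1 + q.2) % 2 = (e + f) % 2 ∧
                (q.1 = q.2 → e % 2 = 0 ∧ f % 2 = 0)),
            (d q : ℝ) * (dzv q.1 q.2 + (-1 : ℝ) ^ f * dzv q.2 q.1) := by
  have hterm : ∀ p : ℕ × ℕ, (fun k : {q : ℕ × ℕ // q.2 ≤ q.1 ∧ 1 ≤ q.2} =>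
        (((k.1.1 : ℝ) + k.1.2 + n + r) ^ e * ((k.1.1 : ℝ) - k.1.2 + r) ^ f) /
          (((ascPochhammer ℝ (n + 1)).eval ((k.1.1 : ℝ) + r)) ^ A *
            ((ascPochhammer ℝ (n + 1)).eval (k.1.2 : ℝ)) ^ A)) (triangleEquiv p) =
      summand A n e f ((p.2 + (1 + p.1 + r) : ℕ) : ℝ) ((1 + p.1 : ℕ) : ℝ) := by
    intro p
    have h1 : ((p.2 + (1 + p.1 + r) : ℕ) : ℝ) = ((p.2 + (1 + p.1) : ℕ) : ℝ) + r := by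
      push_cast; ring
    rw [summand, h1]
    dsimp only [triangleEquiv, Equiv.coe_fn_mk]
    congr 3 <;> ring
  have hsum := summable_summand r hef
  obtain ⟨C, hC, hC1, hswap, hreflect⟩ := exists_symmetric_isPartialFraction A n e f hef
  obtain ⟨v, ⟨c₀, c, rfl⟩, hv⟩ := exists_tsum_eq hC hC1 hsum
  refine ⟨?_, c₀, c, ?_⟩
  · rw [← triangleEquiv.summable_iff]
    exact hsum.congr fun p => (hterm p).symm
  rw [← triangleEquiv.tsum_eq, tsum_congr hterm, hv]
  set c₂ : ℕ → ℕ → ℚ := fun s t => ∑ i ∈ range (n + 1), ∑ j ∈ range (n + 1), C s t i j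
  have hswap' : ∀ s t, c₂ t s = (-1) ^ f * c₂ s t := hswap
  have hreflect' : ∀ s t, c₂ s t = (-1) ^ (s + t + (e + f)) * c₂ s t := hreflect
  have hleft : ∀ t, c₂ 1 t = 0 := fun t => by
    simp only [c₂]
    rw [sum_comm]
    exact sum_eq_zero (hC1 t)
  have hright : ∀ s, c₂ s 1 = 0 := fun s => by rw [hswap', hleft, mul_zero]
  have hIcc : ∀ F : ℕ → ℝ, F 1 = 0 → ∑ s ∈ Icc 1 A, F s = ∑ s ∈ Icc 2 A, F s := fun F hF => by
    rw [← add_sum_Ioc_eq_sum_Icc (by omega : 1 ≤ A), hF, zero_add]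
    rfl
  refine ⟨_, congrArg _ (Eq.trans ?_ (sum_product_eq_sum_filter_symm (Icc 2 A) f c₂ dzv
    (fun q => (q.1 + q.2) % 2 = (e + f) % 2 ∧ (q.1 = q.2 → e % 2 = 0 ∧ f % 2 = 0)) hswap' ?_))⟩
  · rw [hIcc (fun s => ∑ t ∈ Icc 1 A, (c₂ s t : ℝ) * dzv s t) (by simp [hleft])]
    exact sum_congr rfl fun s _ => hIcc (fun t => (c₂ s t : ℝ) * dzv s t) (by simp [hright])
  · rintro ⟨s, t⟩ hq
    dsimp only at hq ⊢
    by_cases hpar : (s + t) % 2 = (e + f) % 2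
    · obtain ⟨rfl, hodd⟩ : s = t ∧ f % 2 = 1 := by omega
      have := hswap' s s
      rw [(Nat.odd_iff.mpr hodd).neg_one_pow] at this
      linarith
    · have := hreflect' s t
      rw [(Nat.odd_iff.mpr (by omega) : Odd (s + t + (e + f))).neg_one_pow] at this
      linarith
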